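/- In a Ptolemy space X satisfying properties (E) and (I), any two distinct Ptolemy circles have at most two points in common. -/

import Mathlib

open scoped ENNReal

namespace Mobius

/-- An extended metric on `X`, allowed to have (at most) one infinitely remote point,
which is recorded in the field `rem`.  Distances take values in `ℝ≥0∞`, and the value `⊤`
occurs exactly on pairs of distinct points one of which is the remote point. -/
structure ExtMetric (X : Type*) where
  d : X → X → ℝ≥0∞
  rem : Option X
  symm : ∀ x y, d x y = d y x
  d_self : ∀ x, d x x = 0
  pos : ∀ x y, x ≠ y → 0 < d x y
  triangle : ∀ x y z, d x z ≤ d x y + d y z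
  d_eq_top_iff : ∀ x y, d x y = ⊤ ↔ (x ≠ y ∧ (rem = some x ∨ rem = some y))

/-- The finite factor of a distance used in cross-ratio triples: infinite factors are
dropped (replaced by `1`), in accordance with the standard conventions for cross-ratio
triples of quadruples containing the infinitely remote point. -/
noncomputable def ExtMetric.fd {X : Type*} (d : ExtMetric X) (x y : X) : ℝ :=
  if d.d x y = ⊤ then 1 else (d.d x y).toReal

/-- A representative in `ℝ³` of the cross-ratio triple
`crt(x,y,z,u) = (d(x,y)d(z,u) : d(x,z)d(y,u) : d(x,u)d(y,z)) ∈ ℝP²`,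
with the standard conventions when the infinitely remote point occurs among the points. -/
noncomputable def crtVec {X : Type*} (d : ExtMetric X) (x y z u : X) : ℝ × ℝ × ℝ :=
  (d.fd x y * d.fd z u, d.fd x z * d.fd y u, d.fd x u * d.fd y z)

/-- A quadruple is admissible if no entry occurs three or four times in it. -/
def Admissible {X : Type*} (x y z u : X) : Prop :=
  ¬(x = y ∧ y = z) ∧ ¬(x = y ∧ y = u) ∧ ¬(x = z ∧ z = u) ∧ ¬(y = z ∧ z = u)

/-- Two vectors in `ℝ³` represent the same point of the projective plane (they are
positively proportional). -/
def ProjEq (v w : ℝ × ℝ × ℝ) : Prop :=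
  ∃ lam : ℝ, 0 < lam ∧ w = lam • v

theorem ProjEq.refl (v : ℝ × ℝ × ℝ) : ProjEq v v :=
  ⟨1, one_pos, (one_smul ℝ v).symm⟩

theorem ProjEq.symm {v w : ℝ × ℝ × ℝ} (h : ProjEq v w) : ProjEq w v := by
  obtain ⟨l, hl, rfl⟩ := h
  exact ⟨l⁻¹, inv_pos.mpr hl, by rw [smul_smul, inv_mul_cancel₀ hl.ne', one_smul]⟩

theorem ProjEq.trans' {v w u : ℝ × ℝ × ℝ} (h1 : ProjEq v w) (h2 : ProjEq v u) :
    ProjEq w u := by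
  obtain ⟨l, hl, rfl⟩ := h1
  obtain ⟨m, hm, rfl⟩ := h2
  refine ⟨m * l⁻¹, by positivity, ?_⟩
  rw [smul_smul, mul_assoc, inv_mul_cancel₀ hl.ne', mul_one]

/-- A Möbius structure on a set `X`: a (maximal) class of pairwise Möbius-equivalent
extended metrics on `X`, i.e. metrics defining the same cross-ratio triples on all
admissible quadruples. -/
structure MobiusStructure (X : Type*) where
  M : Set (ExtMetric X)
  nonempty : M.Nonempty
  compat : ∀ d ∈ M, ∀ d' ∈ M, ∀ x y z u : X, Admissible x y z u →
    ProjEq (crtVec d x y z u) (crtVec d' x y z u)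
  maximal : ∀ d' : ExtMetric X,
    (∀ d ∈ M, ∀ x y z u : X, Admissible x y z u →
      ProjEq (crtVec d x y z u) (crtVec d' x y z u)) → d' ∈ M

/-- The Möbius structure generated by a single extended metric. -/
def MobiusStructure.ofMetric {X : Type*} (d₀ : ExtMetric X) : MobiusStructure X where
  M := {d | ∀ x y z u : X, Admissible x y z u →
    ProjEq (crtVec d₀ x y z u) (crtVec d x y z u)}
  nonempty := ⟨d₀, fun _ _ _ _ _ => ProjEq.refl _⟩
  compat := fun _ hd _ hd' x y z u ha => (hd x y z u ha).trans' (hd' x y z u ha)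
  maximal := fun _ h => h d₀ (fun _ _ _ _ _ => ProjEq.refl _)

/-- A Möbius structure is Ptolemy if the entries of every cross-ratio triple of every
admissible quadruple satisfy the triangle inequality. -/
def IsPtolemyStructure {X : Type*} (S : MobiusStructure X) : Prop :=
  ∀ d ∈ S.M, ∀ x y z u : X, Admissible x y z u →
    (crtVec d x y z u).1 ≤ (crtVec d x y z u).2.1 + (crtVec d x y z u).2.2 ∧
    (crtVec d x y z u).2.1 ≤ (crtVec d x y z u).1 + (crtVec d x y z u).2.2 ∧
    (crtVec d x y z u).2.2 ≤ (crtVec d x y z u).1 + (crtVec d x y z u).2.1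

/-- The topology of a Möbius space: generated by the open balls of the metrics of the
structure (centered at points distinct from the respective remote points) together with
the complements of the closed balls. -/
def mobiusTop {X : Type*} (S : MobiusStructure X) : TopologicalSpace X :=
  TopologicalSpace.generateFrom
    {s | ∃ d ∈ S.M, ∃ x : X, d.rem ≠ some x ∧ ∃ r : ℝ≥0∞, 0 < r ∧ r ≠ ⊤ ∧
      (s = {y | d.d y x < r} ∨ s = {y | r < d.d y x})}

/-- Connected components of subsets with respect to the Möbius topology. -/
def mobiusCCIn {X : Type*} (S : MobiusStructure X) (F : Set X) (x : X) : Set X :=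
  @connectedComponentIn X (mobiusTop S) F x

/-- The pair `(x,z)` separates the pair `(y,u)` in `σ`:  `y` and `u` lie in different
connected components of `σ \ {x,z}`. -/
def SeparatesIn {X : Type*} (S : MobiusStructure X) (σ : Set X) (x z y u : X) : Prop :=
  u ∉ mobiusCCIn S (σ \ {x, z}) y

/-- `σ` is homeomorphic to the circle `S¹` (with respect to the Möbius topology). -/
def HomeoToCircle {X : Type*} (S : MobiusStructure X) (σ : Set X) : Prop :=
  letI : TopologicalSpace X := mobiusTop S
  Nonempty (σ ≃ₜ Metric.sphere (0 : ℂ) 1)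

/-- `X` is homeomorphic to the sphere `Sⁿ ⊆ ℝ^{n+1}` (w.r.t. the Möbius topology). -/
def HomeoToSphere {X : Type*} (S : MobiusStructure X) (n : ℕ) : Prop :=
  letI : TopologicalSpace X := mobiusTop S
  Nonempty (X ≃ₜ Metric.sphere (0 : EuclideanSpace ℝ (Fin (n + 1))) 1)

/-- The subset `A ⊆ X` is homeomorphic to `ℝᵖ` (w.r.t. the Möbius topology). -/
def SubsetHomeoToEuclidean {X : Type*} (S : MobiusStructure X) (A : Set X) (p : ℕ) : Prop :=
  letI : TopologicalSpace X := mobiusTop S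
  Nonempty (A ≃ₜ EuclideanSpace ℝ (Fin p))

/-- The subset `A ⊆ X` is homeomorphic to `ℝ` (w.r.t. the Möbius topology). -/
def SubsetHomeoToReal {X : Type*} (S : MobiusStructure X) (A : Set X) : Prop :=
  letI : TopologicalSpace X := mobiusTop S
  Nonempty (A ≃ₜ ℝ)

/-- A Ptolemy circle: a subset homeomorphic to `S¹` on which the Ptolemy equality holds
for every quadruple of distinct points `(x,y,z,u)` such that `(x,z)` separates `(y,u)`. -/
def IsPtolemyCircle {X : Type*} (S : MobiusStructure X) (σ : Set X) : Prop :=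
  HomeoToCircle S σ ∧
  ∀ d ∈ S.M, ∀ x ∈ σ, ∀ y ∈ σ, ∀ z ∈ σ, ∀ u ∈ σ,
    x ≠ y → x ≠ z → x ≠ u → y ≠ z → y ≠ u → z ≠ u →
    SeparatesIn S σ x z y u →
    d.d x z * d.d y u = d.d x y * d.d z u + d.d x u * d.d y z

/-- A Möbius automorphism of `X`: a bijection preserving all cross-ratio triples. -/
def IsMobiusAuto {X : Type*} (S : MobiusStructure X) (f : X → X) : Prop :=
  Function.Bijective f ∧ ∀ d ∈ S.M, ∀ x y z u : X, Admissible x y z u →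
    ProjEq (crtVec d x y z u) (crtVec d (f x) (f y) (f z) (f u))

/-- A metric sphere between two distinct points `ω`, `ω'`. -/
def IsMetricSphere {X : Type*} (S : MobiusStructure X) (ω ω' : X) (Sp : Set X) : Prop :=
  ∃ d ∈ S.M, d.rem = some ω' ∧ ∃ r : ℝ≥0∞, 0 < r ∧ r ≠ ⊤ ∧ Sp = {x | d.d x ω = r}

/-- A space inversion with respect to `ω`, `ω'` and a metric sphere `Sp` between them. -/
def IsSpaceInversion {X : Type*} (S : MobiusStructure X) (ω ω' : X) (Sp : Set X)
    (φ : X → X) : Prop :=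
  IsMobiusAuto S φ ∧ Function.Involutive φ ∧ (∀ x, φ x ≠ x) ∧ φ ω = ω' ∧
  φ '' Sp = Sp ∧ ∀ σ : Set X, IsPtolemyCircle S σ → ω ∈ σ → ω' ∈ σ → φ '' σ = σ

/-- Property (E): existence of at least one Ptolemy circle. -/
def PropertyE {X : Type*} (S : MobiusStructure X) : Prop :=
  ∃ σ : Set X, IsPtolemyCircle S σ

/-- Property (I): existence and uniqueness of space inversions. -/
def PropertyI {X : Type*} (S : MobiusStructure X) : Prop :=
  ∀ ω ω' : X, ω ≠ ω' → ∀ Sp : Set X, IsMetricSphere S ω ω' Sp →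
    ∃! φ : X → X, IsSpaceInversion S ω ω' Sp φ

/-- The Möbius space is compact. -/
def MobiusCompact {X : Type*} (S : MobiusStructure X) : Prop :=
  letI : TopologicalSpace X := mobiusTop S
  CompactSpace X

/-- Property (H), the homothety property. -/
def PropertyH {X : Type*} (S : MobiusStructure X) : Prop :=
  ∀ ω ω' : X, ω ≠ ω' → ∀ σ : Set X, IsPtolemyCircle S σ → ω ∈ σ → ω' ∈ σ →
    ∀ x x' : X, x ∈ σ \ {ω, ω'} → x' ∈ mobiusCCIn S (σ \ {ω, ω'}) x →
    ∃ γ : X → X, IsMobiusAuto S γ ∧ γ ω = ω ∧ γ ω' = ω' ∧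
      (∀ σ' : Set X, IsPtolemyCircle S σ' → ω ∈ σ' → ω' ∈ σ' →
        γ '' σ' = σ' ∧ ∀ y ∈ σ' \ {ω, ω'}, γ y ∈ mobiusCCIn S (σ' \ {ω, ω'}) y) ∧
      γ x = x'

/-- A Ptolemy line in `X_ω`: a Ptolemy circle through `ω` with `ω` removed. -/
def IsPtolemyLine {X : Type*} (S : MobiusStructure X) (ω : X) (l : Set X) : Prop :=
  ∃ σ : Set X, IsPtolemyCircle S σ ∧ ω ∈ σ ∧ l = σ \ {ω}

/-- `c : ℝ → X` is a unit-speed parameterization of `l ⊆ X` w.r.t. the metric `d`. -/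
def IsUnitSpeed {X : Type*} (d : ExtMetric X) (l : Set X) (c : ℝ → X) : Prop :=
  Set.range c = l ∧ ∀ s t : ℝ, d.d (c s) (c t) = ENNReal.ofReal |s - t|

/-- `b` is a Busemann function of the Ptolemy line `l ⊆ X_ω`:  up to an additive constant,
`b x = lim_{t→∞} (d(x,c(t)) − t)` for a unit-speed parameterization `c` of `l`. -/
def IsBusemannOf {X : Type*} (S : MobiusStructure X) (d : ExtMetric X) (ω : X)
    (l : Set X) (b : X → ℝ) : Prop :=
  IsPtolemyLine S ω l ∧ ∃ c : ℝ → X, IsUnitSpeed d l c ∧ ∃ C : ℝ, ∀ x : X, x ≠ ω →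
    Filter.Tendsto (fun t => (d.d x (c t)).toReal - t) Filter.atTop (nhds (b x + C))

/-- The fiber through `x` of the canonical fibration `π_ω`: the set of points on which
every Busemann function of every Ptolemy line of `X_ω` takes the same value as at `x`. -/
def mobiusFiber {X : Type*} (S : MobiusStructure X) (d : ExtMetric X) (ω : X) (x : X) :
    Set X :=
  {y | y ≠ ω ∧ ∀ (l : Set X) (b : X → ℝ), IsBusemannOf S d ω l b → b y = b x}

/-- The base `B_ω` of the canonical fibration: the set of all fibers. -/
def mobiusBase {X : Type*} (S : MobiusStructure X) (d : ExtMetric X) (ω : X) :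
    Set (Set X) :=
  {F | ∃ x : X, x ≠ ω ∧ F = mobiusFiber S d ω x}

/-- The distance between two fibers. -/
noncomputable def fiberDist {X : Type*} (d : ExtMetric X) (F F' : Set X) : ℝ :=
  sInf {r : ℝ | ∃ x ∈ F, ∃ x' ∈ F', r = (d.d x x').toReal}

/-- Two Möbius spaces are Möbius equivalent: there is a bijection between them
preserving all cross-ratio triples. -/
def MobiusEquiv {X Y : Type*} (S : MobiusStructure X) (S' : MobiusStructure Y) : Prop :=
  ∃ f : X → Y, Function.Bijective f ∧ ∀ d ∈ S.M, ∀ d' ∈ S'.M, ∀ x y z u : X,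
    Admissible x y z u → ProjEq (crtVec d x y z u) (crtVec d' (f x) (f y) (f z) (f u))

/-- The standard extended Euclidean metric on the one-point extension
`ℝ̂ⁿ = ℝⁿ ∪ {∞}`, where `∞` is encoded by `none`. -/
noncomputable def stdExtMetric (n : ℕ) : ExtMetric (Option (EuclideanSpace ℝ (Fin n))) where
  d x y :=
    match x, y with
    | none, none => 0
    | none, some _ => ⊤
    | some _, none => ⊤
    | some a, some b => ENNReal.ofReal (dist a b)
  rem := some none
  symm := by intro x y; cases x <;> cases y <;> simp [dist_comm]
  d_self := by intro x; cases x <;> simp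
  pos := by
    intro x y h
    cases x <;> cases y
    · exact absurd rfl h
    · simp
    · simp
    · simp only [ne_eq, Option.some.injEq] at h
      exact ENNReal.ofReal_pos.mpr (dist_pos.mpr h)
  triangle := by
    intro x y z
    cases x <;> cases y <;> cases z <;>
      simp only [le_refl, le_top, zero_le, zero_add, add_zero, top_add, add_top,
        top_le_iff]
    rw [← ENNReal.ofReal_add dist_nonneg dist_nonneg]
    exact ENNReal.ofReal_le_ofReal (dist_triangle _ _ _)
  d_eq_top_iff := by
    intro x y
    cases x <;> cases y <;>
      simp [ENNReal.ofReal_ne_top]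


section Topology

variable {X : Type*} [TopologicalSpace X] {σ : Set X} {ω : X}

theorem exists_continuousOn_injOn_diff_singleton
    (e : σ ≃ₜ Metric.sphere (0 : ℂ) 1) (hω : ω ∈ σ) :
    ∃ g : X → ℝ, ContinuousOn g (σ \ {ω}) ∧ Set.InjOn g (σ \ {ω}) := by
  classical
  have : Fact (Module.finrank ℝ ℂ = 1 + 1) := Complex.finrank_real_complex_fact
  let ψ := stereographic' 1 (e ⟨ω, hω⟩)
  have hsrc : ∀ x (h : x ∈ σ \ {ω}), e ⟨x, h.1⟩ ∈ ψ.source := by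
    intro x h
    rw [stereographic'_source, Set.mem_compl_singleton_iff]
    intro h'
    exact h.2 (congrArg Subtype.val (e.injective h'))
  let F : ↥(σ \ {ω}) → ℝ := fun x => ψ (e ⟨x, x.2.1⟩) 0
  have hFc : Continuous F := by
    have h1 : Continuous fun x : ↥(σ \ {ω}) => e ⟨x, x.2.1⟩ :=
      e.continuous.comp (Continuous.subtype_mk continuous_subtype_val _)
    have h2 : Continuous fun x : ↥(σ \ {ω}) => ψ (e ⟨x, x.2.1⟩) :=
      ψ.continuousOn.comp_continuous h1 fun x => hsrc x x.2
    exact (EuclideanSpace.proj (𝕜 := ℝ) (0 : Fin 1)).continuous.comp h2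
  have hFi : Function.Injective F := by
    intro x y hxy
    have h1 : ψ (e ⟨x, x.2.1⟩) = ψ (e ⟨y, y.2.1⟩) := by
      ext i
      rw [Subsingleton.elim i 0]
      exact hxy
    have h2 := e.injective (ψ.injOn (hsrc x x.2) (hsrc y y.2) h1)
    exact Subtype.ext (Subtype.mk.inj h2)
  refine ⟨fun x => if h : x ∈ σ \ {ω} then F ⟨x, h⟩ else 0, ?_, ?_⟩
  · rw [continuousOn_iff_continuous_domRestrict]
    convert hFc using 1
    funext x
    simp only [Set.domRestrict_apply]
    rw [dif_pos x.2]
  · intro x hx y hy hxy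
    simp only [dif_pos hx, dif_pos hy] at hxy
    exact congrArg Subtype.val (hFi hxy)

theorem isPreconnected_and_infinite_diff_singleton
    (e : σ ≃ₜ Metric.sphere (0 : ℂ) 1) (hω : ω ∈ σ) :
    IsPreconnected (σ \ {ω}) ∧ (σ \ {ω}).Infinite := by
  have : Fact (Module.finrank ℝ ℂ = 1 + 1) := Complex.finrank_real_complex_fact
  let ψ := stereographic' 1 (e ⟨ω, hω⟩)
  let c : EuclideanSpace ℝ (Fin 1) → X := fun t => e.symm (ψ.symm t)
  have htgt : ∀ t, t ∈ ψ.target := fun t => by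
    rw [stereographic'_target]; exact Set.mem_univ t
  have hc : Continuous c := by
    have h1 : Continuous fun t => ψ.symm t := by
      rw [← continuousOn_univ, ← stereographic'_target (n := 1) (e ⟨ω, hω⟩)]
      exact ψ.continuousOn_symm
    exact continuous_subtype_val.comp (e.symm.continuous.comp h1)
  have hinj : Function.Injective c := by
    intro s t hst
    exact ψ.symm.injOn (htgt s) (htgt t) (e.symm.injective (Subtype.ext hst))
  have hrange : Set.range c = σ \ {ω} := by
    ext x
    constructor
    · rintro ⟨t, rfl⟩
      refine ⟨(e.symm (ψ.symm t)).2, fun h => ?_⟩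
      have h1 : ψ.symm t ∈ ψ.source := ψ.map_target (htgt t)
      rw [stereographic'_source, Set.mem_compl_singleton_iff] at h1
      apply h1
      rw [← e.apply_symm_apply (ψ.symm t)]
      exact congrArg e (Subtype.ext h)
    · rintro ⟨hx, hxω⟩
      have h1 : e ⟨x, hx⟩ ∈ ψ.source := by
        rw [stereographic'_source, Set.mem_compl_singleton_iff]
        intro h'
        exact hxω (congrArg Subtype.val (e.injective h'))
      refine ⟨ψ (e ⟨x, hx⟩), ?_⟩
      simp only [c]
      rw [ψ.left_inv h1, e.symm_apply_apply]
  rw [← hrange]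
  exact ⟨isPreconnected_range hc, Set.infinite_range_of_injective hinj⟩

theorem notMem_connectedComponentIn_of_lt_of_lt {g : X → ℝ}
    (hg : ContinuousOn g (σ \ {ω})) (hinj : Set.InjOn g (σ \ {ω})) {x y z : X}
    (hx : x ∈ σ \ {ω}) (hy : y ∈ σ \ {ω}) (hxy : g x < g y) (hyz : g y < g z) :
    z ∉ connectedComponentIn (σ \ {ω, y}) x := by
  intro hz
  have hsub : connectedComponentIn (σ \ {ω, y}) x ⊆ σ \ {ω} :=
    (connectedComponentIn_subset _ _).trans
      (Set.sdiff_subset_sdiff_right (by simp))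
  have hxm : x ∈ connectedComponentIn (σ \ {ω, y}) x := by
    apply mem_connectedComponentIn
    refine ⟨hx.1, ?_⟩
    rintro (h | h)
    · exact hx.2 h
    · rw [Set.mem_singleton_iff.1 h] at hxy
      exact lt_irrefl _ hxy
  obtain ⟨w, hw, hwy⟩ := isPreconnected_connectedComponentIn.intermediate_value hxm hz
    (hg.mono hsub) ⟨hxy.le, hyz.le⟩
  have : w = y := hinj (hsub hw) hy hwy
  subst this
  exact (connectedComponentIn_subset _ _ hw).2 (by simp)

end Topology

section RealLine

theorem eq_univ_of_opposite_mem {C : Set ℝ} {c e : ℝ} (hc : c ∈ C) (he : e ∈ C) (hce : c ≠ e)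
    (h : ∀ c ∈ C, ∀ e ∈ C, ∀ u, (u - c) * (e - c) < 0 → u ∈ C) : C = Set.univ := by
  wlog hlt : c < e generalizing c e
  · exact this he hc hce.symm (lt_of_le_of_ne (not_lt.1 hlt) hce.symm)
  have h1 : ∀ u, u < c → u ∈ C := fun u hu =>
    h c hc e he u (mul_neg_of_neg_of_pos (by linarith) (by linarith))
  refine Set.eq_univ_of_forall fun u => ?_
  rcases lt_or_ge u c with hu | hu
  · exact h1 u hu
  · exact h (c - 1) (h1 _ (by linarith)) (c - 2) (h1 _ (by linarith)) u
      (mul_neg_of_pos_of_neg (by linarith) (by linarith))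

theorem eq_univ_of_add_mem {A : Set ℝ} {a t : ℝ} (ht : 0 < t) (ha : a ∈ A)
    (h : ∀ x ∈ A, ∀ s, |s| ≤ t → x + s ∈ A) : A = Set.univ := by
  refine Set.eq_univ_of_forall fun u => ?_
  obtain ⟨n, hn⟩ := exists_nat_gt (|u - a| / t)
  have hn0 : (0 : ℝ) < n := lt_of_le_of_lt (by positivity) hn
  have hs : |(u - a) / n| ≤ t := by
    rw [abs_div, abs_of_pos hn0, div_le_iff₀ hn0]
    rw [div_lt_iff₀ ht] at hn
    linarith
  have key : ∀ k : ℕ, a + k * ((u - a) / n) ∈ A := by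
    intro k
    induction k with
    | zero => simpa using ha
    | succ k ih =>
      have := h _ ih _ hs
      convert this using 1
      push_cast
      ring
  have := key n
  rwa [mul_div_cancel₀ _ hn0.ne', add_sub_cancel] at this

end RealLine

namespace ExtMetric

variable {X : Type*} (d : ExtMetric X)

theorem fd_symm (x y : X) : d.fd x y = d.fd y x := by
  simp only [fd, d.symm x y]

theorem fd_self (x : X) : d.fd x x = 0 := by
  simp [fd, d.d_self]

theorem fd_pos {x y : X} (h : x ≠ y) : 0 < d.fd x y := by
  unfold fd
  split_ifs with h'
  · exact one_pos
  · exact ENNReal.toReal_pos (d.pos x y h).ne' h'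

theorem fd_nonneg (x y : X) : 0 ≤ d.fd x y := by
  rcases eq_or_ne x y with rfl | h
  · rw [fd_self]
  · exact (d.fd_pos h).le

variable {d}

theorem fd_rem_right {ω x : X} (h : d.rem = some ω) (hx : x ≠ ω) : d.fd x ω = 1 := by
  rw [fd, if_pos ((d.d_eq_top_iff x ω).2 ⟨hx, Or.inr h⟩)]

theorem fd_rem_left {ω x : X} (h : d.rem = some ω) (hx : x ≠ ω) : d.fd ω x = 1 := by
  rw [fd_symm, fd_rem_right h hx]

theorem d_eq_ofReal_fd {x y : X} (h : d.d x y ≠ ⊤) : d.d x y = ENNReal.ofReal (d.fd x y) := by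
  rw [fd, if_neg h, ENNReal.ofReal_toReal h]

theorem d_ne_top {ω x y : X} (h : d.rem = some ω) (hx : x ≠ ω) (hy : y ≠ ω) :
    d.d x y ≠ ⊤ := by
  intro h'
  rcases ((d.d_eq_top_iff x y).1 h').2 with h1 | h1
  · exact hx (Option.some.inj (h1.symm.trans h))
  · exact hy (Option.some.inj (h1.symm.trans h))

theorem fd_eq_toReal {ω x y : X} (h : d.rem = some ω) (hx : x ≠ ω) (hy : y ≠ ω) :
    d.fd x y = (d.d x y).toReal := by
  rw [fd, if_neg (d_ne_top h hx hy)]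

end ExtMetric

section Inversion

variable {X : Type*}

/-- The scaling factor of the metric inversion of `d` at `ω`. -/
noncomputable def inversionWeight (d : ExtMetric X) (ω x : X) : ℝ :=
  open Classical in if x = ω then 1 else d.fd x ω

theorem inversionWeight_pos (d : ExtMetric X) (ω x : X) : 0 < inversionWeight d ω x := by
  unfold inversionWeight
  split_ifs with h
  · exact one_pos
  · exact d.fd_pos h

theorem inversionWeight_self (d : ExtMetric X) (ω : X) : inversionWeight d ω ω = 1 :=
  if_pos rfl

theorem inversionWeight_of_ne (d : ExtMetric X) {ω x : X} (h : x ≠ ω) :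
    inversionWeight d ω x = d.fd x ω :=
  if_neg h

open Classical in
/-- The metric inversion of `d` at `ω`, with infinitely remote point `ω`. -/
noncomputable def inversionMetric (d : ExtMetric X) (ω : X)
    (hpt : ∀ x y z, x ≠ y → y ≠ z → x ≠ z → x ≠ ω → y ≠ ω → z ≠ ω →
      d.fd x z * d.fd y ω ≤ d.fd x y * d.fd z ω + d.fd x ω * d.fd y z) : ExtMetric X where
  d x y := if x = y then 0 else if x = ω ∨ y = ω then ⊤ else
    ENNReal.ofReal (d.fd x y / (inversionWeight d ω x * inversionWeight d ω y))
  rem := some ω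
  symm x y := by
    simp only [d.fd_symm x y, mul_comm (inversionWeight d ω x), eq_comm (a := x) (b := y),
      or_comm (a := x = ω)]
  d_self x := by simp
  pos x y h := by
    rw [if_neg h]
    split_ifs
    · simp
    · exact ENNReal.ofReal_pos.2 (div_pos (d.fd_pos h)
        (mul_pos (inversionWeight_pos d ω x) (inversionWeight_pos d ω y)))
  triangle x y z := by
    by_cases hxz : x = z
    · simp [hxz]
    by_cases hxy : x = y
    · simp [hxy]
    by_cases hyz : y = z
    · simp [hyz]
    simp only [if_neg hxz, if_neg hxy, if_neg hyz]
    by_cases hx : x = ω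
    · simp [hx]
    by_cases hy : y = ω
    · simp [hy]
    by_cases hz : z = ω
    · simp [hz]
    simp only [hx, hy, hz, or_self, if_false]
    have px := d.fd_pos hx
    have py := d.fd_pos hy
    have pz := d.fd_pos hz
    have pxy := d.fd_pos hxy
    have pyz := d.fd_pos hyz
    rw [inversionWeight_of_ne d hx, inversionWeight_of_ne d hy, inversionWeight_of_ne d hz,
      ← ENNReal.ofReal_add (by positivity) (by positivity)]
    apply ENNReal.ofReal_le_ofReal
    have h := hpt x y z hxy hyz hxz hx hy hz
    rw [div_add_div _ _ (by positivity) (by positivity), div_le_div_iff₀ (by positivity)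
      (by positivity)]
    have h2 := mul_le_mul_of_nonneg_right h
      (show 0 ≤ d.fd x ω * d.fd y ω * d.fd z ω by positivity)
    linarith
  d_eq_top_iff x y := by
    by_cases hxy : x = y
    · simp [hxy]
    by_cases hx : x = ω
    · simp [hx, eq_comm]
    by_cases hy : y = ω
    · simp [hy]
    simp [hxy, hx, hy, eq_comm (a := ω)]

theorem fd_inversionMetric (d : ExtMetric X) (ω : X) (hpt) (x y : X) :
    (inversionMetric d ω hpt).fd x y =
      d.fd x y / (inversionWeight d ω x * inversionWeight d ω y) := by
  have hrem : (inversionMetric d ω hpt).rem = some ω := rfl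
  by_cases hxy : x = y
  · simp [hxy, ExtMetric.fd_self]
  by_cases hx : x = ω
  · subst hx
    rw [ExtMetric.fd_rem_left hrem (Ne.symm hxy), inversionWeight_self,
      inversionWeight_of_ne d (Ne.symm hxy), one_mul, d.fd_symm x y,
      div_self (d.fd_pos (Ne.symm hxy)).ne']
  by_cases hy : y = ω
  · subst hy
    rw [ExtMetric.fd_rem_right hrem hxy, inversionWeight_self,
      inversionWeight_of_ne d hxy, mul_one, div_self (d.fd_pos hxy).ne']
  rw [ExtMetric.fd_eq_toReal hrem hx hy]
  simp only [inversionMetric, hxy, hx, hy, or_self, if_false]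
  exact ENNReal.toReal_ofReal (div_nonneg (d.fd_nonneg x y)
    (mul_pos (inversionWeight_pos d ω x) (inversionWeight_pos d ω y)).le)

theorem exists_mem_rem_eq {S : MobiusStructure X} (hpt : IsPtolemyStructure S) (ω : X) :
    ∃ d ∈ S.M, d.rem = some ω := by
  obtain ⟨d, hd⟩ := S.nonempty
  have hd' : ∀ x y z, x ≠ y → y ≠ z → x ≠ z → x ≠ ω → y ≠ ω → z ≠ ω →
      d.fd x z * d.fd y ω ≤ d.fd x y * d.fd z ω + d.fd x ω * d.fd y z := by
    intro x y z hxy hyz hxz hx hy hz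
    exact (hpt d hd x y z ω ⟨fun h => hxy h.1, fun h => hxy h.1, fun h => hxz h.1,
      fun h => hyz h.1⟩).2.1
  refine ⟨inversionMetric d ω hd', S.maximal _ fun d₁ hd₁ x y z u ha => ?_, rfl⟩
  have h1 : ProjEq (crtVec d x y z u) (crtVec (inversionMetric d ω hd') x y z u) := by
    have px := inversionWeight_pos d ω x
    have py := inversionWeight_pos d ω y
    have pz := inversionWeight_pos d ω z
    have pu := inversionWeight_pos d ω u
    refine ⟨(inversionWeight d ω x * inversionWeight d ω y * inversionWeight d ω z *
      inversionWeight d ω u)⁻¹, by positivity, ?_⟩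
    simp only [crtVec, fd_inversionMetric, Prod.smul_mk, smul_eq_mul, Prod.mk.injEq]
    refine ⟨?_, ?_, ?_⟩ <;> field_simp
  exact (S.compat d hd d₁ hd₁ x y z u ha).trans' h1

end Inversion

section PtolemyCircle

variable {X : Type*} {S : MobiusStructure X} {σ : Set X} {ω : X} {d : ExtMetric X}

theorem IsPtolemyCircle.isPreconnected_diff_singleton (hσ : IsPtolemyCircle S σ) (hω : ω ∈ σ) :
    @IsPreconnected X (mobiusTop S) (σ \ {ω}) := by
  let : TopologicalSpace X := mobiusTop S
  obtain ⟨e⟩ := hσ.1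
  exact (isPreconnected_and_infinite_diff_singleton e hω).1

theorem IsPtolemyCircle.infinite_diff_singleton (hσ : IsPtolemyCircle S σ) (hω : ω ∈ σ) :
    (σ \ {ω}).Infinite := by
  let : TopologicalSpace X := mobiusTop S
  obtain ⟨e⟩ := hσ.1
  exact (isPreconnected_and_infinite_diff_singleton e hω).2

theorem IsPtolemyCircle.exists_order (hσ : IsPtolemyCircle S σ) (hω : ω ∈ σ) :
    ∃ g : X → ℝ, Set.InjOn g (σ \ {ω}) ∧
      ∀ x ∈ σ \ {ω}, ∀ y ∈ σ \ {ω}, ∀ z ∈ σ \ {ω}, g x < g y → g y < g z →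
        SeparatesIn S σ ω y x z := by
  let : TopologicalSpace X := mobiusTop S
  obtain ⟨e⟩ := hσ.1
  obtain ⟨g, hg, hinj⟩ := exists_continuousOn_injOn_diff_singleton e hω
  exact ⟨g, hinj, fun x hx y hy z _ hxy hyz =>
    notMem_connectedComponentIn_of_lt_of_lt hg hinj hx hy hxy hyz⟩

theorem IsPtolemyCircle.fd_add_of_separatesIn (hpt : IsPtolemyStructure S)
    (hσ : IsPtolemyCircle S σ) (hω : ω ∈ σ) (hd : d ∈ S.M) (hrem : d.rem = some ω)
    {x y z : X} (hx : x ∈ σ \ {ω}) (hy : y ∈ σ \ {ω}) (hz : z ∈ σ \ {ω})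
    (hxy : x ≠ y) (hyz : y ≠ z) (hxz : x ≠ z) (hsep : SeparatesIn S σ ω y x z) :
    d.fd x z = d.fd x y + d.fd y z := by
  obtain ⟨hx, hxω⟩ := hx
  obtain ⟨hy, hyω⟩ := hy
  obtain ⟨hz, hzω⟩ := hz
  rw [Set.mem_singleton_iff] at hxω hyω hzω
  obtain ⟨v, hv, hv'⟩ := (hσ.infinite_diff_singleton hω).exists_notMem_finite
    (Set.toFinite {x, y, z})
  simp only [Set.mem_insert_iff, Set.mem_singleton_iff, not_or] at hv'
  have hvω : ω ≠ v := fun h => hv.2 h.symm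
  have hvx : x ≠ v := fun h => hv'.1 h.symm
  have hvy : y ≠ v := fun h => hv'.2.1 h.symm
  have hvz : z ≠ v := fun h => hv'.2.2 h.symm
  obtain ⟨d', hd', hrem'⟩ := exists_mem_rem_eq hpt v
  have h := congrArg ENNReal.toReal (hσ.2 d' hd' ω hω x hx y hy z hz (Ne.symm hxω) (Ne.symm hyω)
    (Ne.symm hzω) hxy hxz hyz hsep)
  have ht : ∀ {p q : X}, p ≠ v → q ≠ v → d'.d p q ≠ ⊤ := fun hp hq =>
    ExtMetric.d_ne_top hrem' hp hq
  rw [ENNReal.toReal_add (ENNReal.mul_ne_top (ht hvω hvx) (ht hvy hvz))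
    (ENNReal.mul_ne_top (ht hvω hvz) (ht hvx hvy))] at h
  simp only [ENNReal.toReal_mul] at h
  simp only [← ExtMetric.fd_eq_toReal hrem', hvω, hvx, hvy, hvz, ne_eq, not_false_eq_true] at h
  obtain ⟨l, hl, hlam⟩ := S.compat d' hd' d hd ω x y z ⟨fun h => hxω h.1.symm,
    fun h => hxω h.1.symm, fun h => hyω h.1.symm, fun h => hxy h.1⟩
  simp only [crtVec, Prod.smul_mk, smul_eq_mul, Prod.mk.injEq,
    ExtMetric.fd_rem_left hrem hxω, ExtMetric.fd_rem_left hrem hyω,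
    ExtMetric.fd_rem_left hrem hzω, one_mul] at hlam
  obtain ⟨h1, h2, h3⟩ := hlam
  rw [h1, h2, h3, h]
  ring

/-- A Ptolemy circle with the infinitely remote point removed embeds isometrically into `ℝ`. -/
theorem IsPtolemyCircle.exists_coordinate (hpt : IsPtolemyStructure S)
    (hσ : IsPtolemyCircle S σ) (hω : ω ∈ σ) (hd : d ∈ S.M) (hrem : d.rem = some ω) :
    ∃ f : X → ℝ, ∀ x ∈ σ \ {ω}, ∀ y ∈ σ \ {ω}, |f x - f y| = d.fd x y := by
  obtain ⟨g, hinj, hg⟩ := hσ.exists_order hω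
  have T : ∀ x ∈ σ \ {ω}, ∀ y ∈ σ \ {ω}, ∀ z ∈ σ \ {ω}, g x ≤ g y → g y ≤ g z →
      d.fd x z = d.fd x y + d.fd y z := by
    intro x hx y hy z hz hxy hyz
    rcases hxy.eq_or_lt with h | h
    · rw [hinj hx hy h, d.fd_self, zero_add]
    rcases hyz.eq_or_lt with h' | h'
    · rw [hinj hy hz h', d.fd_self, add_zero]
    exact hσ.fd_add_of_separatesIn hpt hω hd hrem hx hy hz (fun e => h.ne (by rw [e]))
      (fun e => h'.ne (by rw [e])) (fun e => (h.trans h').ne (by rw [e]))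
      (hg x hx y hy z hz h h')
  obtain ⟨a, ha⟩ := (hσ.infinite_diff_singleton hω).nonempty
  refine ⟨fun x => if g a ≤ g x then d.fd a x else -d.fd a x, ?_⟩
  have key : ∀ x ∈ σ \ {ω}, ∀ y ∈ σ \ {ω}, g x ≤ g y →
      |(if g a ≤ g x then d.fd a x else -d.fd a x) -
        (if g a ≤ g y then d.fd a y else -d.fd a y)| = d.fd x y := by
    intro x hx y hy hxy
    have s1 := d.fd_symm x a
    have s2 := d.fd_symm y a
    rw [abs_sub_comm, ← abs_of_nonneg (d.fd_nonneg x y)]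
    congr 1
    split_ifs with h1 h2 h2
    · linarith [T a ha x hx y hy h2 hxy]
    · linarith [T x hx a ha y hy (not_le.1 h2).le h1]
    · exact absurd (h2.trans hxy) h1
    · linarith [T x hx y hy a ha hxy (not_le.1 h1).le]
  intro x hx y hy
  rcases le_total (g x) (g y) with h | h
  · exact key x hx y hy h
  · rw [abs_sub_comm, d.fd_symm]
    exact key y hy x hx h

theorem IsPtolemyCircle.exists_fd_eq (hσ : IsPtolemyCircle S σ) (hω : ω ∈ σ) (hd : d ∈ S.M)
    (hrem : d.rem = some ω) {a b : X} (ha : a ∈ σ \ {ω}) (hb : b ∈ σ \ {ω}) {r : ℝ}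
    (hr : 0 < r) (hrb : r ≤ d.fd a b) : ∃ p ∈ σ \ {ω}, d.fd a p = r := by
  by_contra! hcon
  let : TopologicalSpace X := mobiusTop S
  have hpre : IsPreconnected (σ \ {ω}) := hσ.isPreconnected_diff_singleton hω
  have hra : d.rem ≠ some a := fun h => ha.2 (Option.some.inj (h.symm.trans hrem))
  have hr0 : 0 < ENNReal.ofReal r := ENNReal.ofReal_pos.2 hr
  have ho : ∀ s, (s = {y | d.d y a < ENNReal.ofReal r} ∨ s = {y | ENNReal.ofReal r < d.d y a}) →
      IsOpen s := fun s hs =>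
    TopologicalSpace.isOpen_generateFrom_of_mem
      ⟨d, hd, a, hra, _, hr0, ENNReal.ofReal_ne_top, hs⟩
  have hdfd : ∀ y ∈ σ \ {ω}, d.d y a = ENNReal.ofReal (d.fd a y) := fun y hy => by
    rw [d.fd_symm, ExtMetric.d_eq_ofReal_fd (ExtMetric.d_ne_top hrem hy.2 ha.2)]
  obtain ⟨y, -, hy1, hy2⟩ := hpre _ _ (ho _ (Or.inl rfl)) (ho _ (Or.inr rfl))
    (fun y hy => by
      rcases lt_or_gt_of_ne (hcon y hy) with h | h
      · left
        rw [Set.mem_ofPred_eq, hdfd y hy]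
        exact (ENNReal.ofReal_lt_ofReal_iff hr).2 h
      · right
        rw [Set.mem_ofPred_eq, hdfd y hy]
        exact (ENNReal.ofReal_lt_ofReal_iff (hr.trans h)).2 h)
    ⟨a, ha, by rw [Set.mem_ofPred_eq, d.d_self]; exact hr0⟩
    ⟨b, hb, by
      rw [Set.mem_ofPred_eq, hdfd b hb]
      have h := lt_of_le_of_ne hrb (hcon b hb).symm
      exact (ENNReal.ofReal_lt_ofReal_iff (hr.trans h)).2 h⟩
  rw [Set.mem_ofPred_eq] at hy1 hy2
  exact lt_asymm hy1 hy2

/-- The space inversion of radius `r` centred at `a`, expressed in a metric with infinitely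
remote point `ω`. -/
theorem PropertyI.exists_inversion (hI : PropertyI S) (hd : d ∈ S.M) (hrem : d.rem = some ω)
    {a : X} (ha : a ≠ ω) {r : ℝ} (hr : 0 < r) :
    ∃ φ : X → X, (∀ x, φ x ≠ x) ∧
      (∀ x, x ≠ ω → d.fd a x = r → d.fd a (φ x) = r) ∧
      (∀ τ, IsPtolemyCircle S τ → a ∈ τ → ω ∈ τ → ∀ x ∈ τ, x ≠ a → φ x ∈ τ \ {ω}) ∧
      ∀ x y, x ≠ ω → y ≠ ω → x ≠ a → y ≠ a → ∃ l : ℝ, 0 < l ∧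
        d.fd (φ x) (φ y) = l * d.fd x y ∧ d.fd a (φ y) = l * d.fd a x ∧
        d.fd a (φ x) = l * d.fd a y := by
  obtain ⟨φ, ⟨⟨hbij, hcr⟩, hinv, hfix, hφa, hSp, hcirc⟩, -⟩ := hI a ω ha
    {x | d.d x a = ENNReal.ofReal r}
    ⟨d, hd, hrem, _, ENNReal.ofReal_pos.2 hr, ENNReal.ofReal_ne_top, rfl⟩
  have hφω : φ ω = a := by rw [← hφa, hinv]
  have hneω : ∀ x, x ≠ a → φ x ≠ ω := fun x hx h => hx (by rw [← hinv x, h, hφω])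
  refine ⟨φ, hfix, ?_, ?_, ?_⟩
  · intro x hx hxr
    have h1 : x ∈ {x | d.d x a = ENNReal.ofReal r} := by
      rw [Set.mem_ofPred_eq, ExtMetric.d_eq_ofReal_fd (ExtMetric.d_ne_top hrem hx ha),
        d.fd_symm, hxr]
    have h2 : φ x ∈ {x | d.d x a = ENNReal.ofReal r} := hSp ▸ Set.mem_image_of_mem φ h1
    rw [Set.mem_ofPred_eq] at h2
    rw [d.fd_symm, ExtMetric.fd, h2, if_neg ENNReal.ofReal_ne_top, ENNReal.toReal_ofReal hr.le]
  · intro τ hτ haτ hωτ x hx hxa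
    exact ⟨hcirc τ hτ haτ hωτ ▸ Set.mem_image_of_mem φ hx, hneω x hxa⟩
  · intro x y hx hy hxa hya
    obtain ⟨l, hl, h⟩ := hcr d hd a ω x y ⟨fun h => ha h.1, fun h => ha h.1,
      fun h => hxa h.1.symm, fun h => hx h.1.symm⟩
    simp only [crtVec, hφa, hφω, Prod.smul_mk, smul_eq_mul, Prod.mk.injEq,
      ExtMetric.fd_rem_left hrem hx, ExtMetric.fd_rem_left hrem hy,
      ExtMetric.fd_rem_left hrem (hneω x hxa), ExtMetric.fd_rem_left hrem (hneω y hya),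
      ExtMetric.fd_rem_left hrem ha, ExtMetric.fd_rem_right hrem ha, one_mul, mul_one] at h
    exact ⟨l, hl, h⟩

theorem exists_reflection (hI : PropertyI S) (hσ : IsPtolemyCircle S σ) (hω : ω ∈ σ)
    (hd : d ∈ S.M) (hrem : d.rem = some ω) {f : X → ℝ}
    (hf : ∀ x ∈ σ \ {ω}, ∀ y ∈ σ \ {ω}, |f x - f y| = d.fd x y) {a p : X}
    (ha : a ∈ σ \ {ω}) (hp : p ∈ σ \ {ω}) :
    ∃ q ∈ σ \ {ω}, f q = 2 * f a - f p := by
  rcases eq_or_ne a p with rfl | hap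
  · exact ⟨a, ha, by ring⟩
  obtain ⟨φ, hfix, hsph, hcirc, -⟩ := hI.exists_inversion hd hrem ha.2 (d.fd_pos hap)
  have hq := hcirc σ hσ ha.1 hω p hp.1 hap.symm
  refine ⟨φ p, hq, ?_⟩
  have h1 := hsph p hp.2 rfl
  rw [← hf a ha _ hq, ← hf a ha p hp] at h1
  rcases abs_eq_abs.1 h1 with h | h
  · have h2 : d.fd (φ p) p = 0 := by
      rw [← hf _ hq p hp, abs_eq_zero]
      linarith
    exact absurd h2 (d.fd_pos (hfix p)).ne'
  · linarith

theorem IsPtolemyCircle.image_coordinate_eq_univ (hI : PropertyI S) (hσ : IsPtolemyCircle S σ)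
    (hω : ω ∈ σ) (hd : d ∈ S.M) (hrem : d.rem = some ω) {f : X → ℝ}
    (hf : ∀ x ∈ σ \ {ω}, ∀ y ∈ σ \ {ω}, |f x - f y| = d.fd x y) :
    f '' (σ \ {ω}) = Set.univ := by
  obtain ⟨a, ha, b, hb, hab⟩ := (hσ.infinite_diff_singleton hω).nontrivial
  have hpos := d.fd_pos hab
  refine eq_univ_of_add_mem (t := d.fd a b / 2) (by positivity) (Set.mem_image_of_mem f ha) ?_
  rintro _ ⟨x, hx, rfl⟩ s hs
  rcases eq_or_ne s 0 with rfl | hs0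
  · rw [add_zero]
    exact Set.mem_image_of_mem f hx
  obtain ⟨c, hc, hxc⟩ : ∃ c ∈ σ \ {ω}, |s| ≤ d.fd x c := by
    by_contra! hcon
    have h1 := hcon a ha
    have h2 := hcon b hb
    rw [← hf x hx a ha] at h1
    rw [← hf x hx b hb] at h2
    rw [← hf a ha b hb] at hs
    have h3 := abs_sub_le (f a) (f x) (f b)
    rw [abs_sub_comm (f a) (f x)] at h3
    linarith
  obtain ⟨p, hp, hxp⟩ := hσ.exists_fd_eq hω hd hrem hx hc (abs_pos.2 hs0) hxc
  rw [← hf x hx p hp] at hxp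
  rcases abs_eq_abs.1 hxp with h | h
  · obtain ⟨q, hq, hfq⟩ := exists_reflection hI hσ hω hd hrem hf hx hp
    exact ⟨q, hq, by linarith⟩
  · exact ⟨p, hp, by linarith⟩

theorem IsPtolemyCircle.subset_of_three_mem (hpt : IsPtolemyStructure S) (hI : PropertyI S)
    {σ' : Set X} (hσ : IsPtolemyCircle S σ) (hσ' : IsPtolemyCircle S σ') {a b : X}
    (hω : ω ∈ σ ∩ σ') (ha : a ∈ σ ∩ σ') (hb : b ∈ σ ∩ σ') (haω : a ≠ ω) (hbω : b ≠ ω)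
    (hab : a ≠ b) : σ ⊆ σ' := by
  obtain ⟨d, hd, hrem⟩ := exists_mem_rem_eq hpt ω
  obtain ⟨f, hf⟩ := hσ.exists_coordinate hpt hω.1 hd hrem
  have hinj : ∀ x ∈ σ \ {ω}, ∀ y ∈ σ \ {ω}, f x = f y → x = y := by
    intro x hx y hy hxy
    by_contra hne
    have h := hf x hx y hy
    rw [hxy, sub_self, abs_zero] at h
    exact (d.fd_pos hne).ne h
  have hsurj := hσ.image_coordinate_eq_univ hI hω.1 hd hrem hf
  have hC : f '' ((σ ∩ σ') \ {ω}) = Set.univ := by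
    refine eq_univ_of_opposite_mem (Set.mem_image_of_mem f ⟨ha, haω⟩)
      (Set.mem_image_of_mem f ⟨hb, hbω⟩)
      (fun h => hab (hinj a ⟨ha.1, haω⟩ b ⟨hb.1, hbω⟩ h)) ?_
    rintro _ ⟨c, ⟨hc, hcω⟩, rfl⟩ _ ⟨e, ⟨he, heω⟩, rfl⟩ u hu
    have hcσ : c ∈ σ \ {ω} := ⟨hc.1, hcω⟩
    have heσ : e ∈ σ \ {ω} := ⟨he.1, heω⟩
    have hce : c ≠ e := by
      rintro rfl
      simp at hu
    obtain ⟨r, hr, hr2⟩ : ∃ r : ℝ, 0 < r ∧ r ^ 2 = -((u - f c) * (f e - f c)) :=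
      ⟨√(-((u - f c) * (f e - f c))), Real.sqrt_pos.2 (by linarith), Real.sq_sqrt (by linarith)⟩
    obtain ⟨φ, hfix, hsph, hcirc, hφ⟩ := hI.exists_inversion hd hrem hcω hr
    obtain ⟨p, hp, hfp⟩ : f c + r ∈ f '' (σ \ {ω}) := hsurj ▸ Set.mem_univ _
    have hcp : d.fd c p = r := by
      rw [← hf c hcσ p hp, hfp, sub_add_cancel_left, abs_neg, abs_of_pos hr]
    have hpc : p ≠ c := by
      rintro rfl
      rw [d.fd_self] at hcp
      exact hr.ne hcp
    have hφp := hcirc σ hσ hc.1 hω.1 p hp.1 hpc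
    have hφe := hcirc σ hσ hc.1 hω.1 e he.1 hce.symm
    have hφe' := hcirc σ' hσ' hc.2 hω.2 e he.2 hce.symm
    refine ⟨φ e, ⟨⟨hφe.1, hφe'.1⟩, hφe.2⟩, ?_⟩
    have hfφp : f (φ p) = f c - r := by
      have h1 := hsph p hp.2 hcp
      rw [← hf c hcσ _ hφp] at h1
      rcases (abs_eq hr.le).1 h1 with h | h
      · linarith
      · exact absurd (hinj _ hφp p hp (by linarith)) (hfix p)
    obtain ⟨l, hl, h1, h2, h3⟩ := hφ e p heω hp.2 hce.symm hpc
    rw [← hf _ hφe _ hφp, ← hf e heσ p hp, hfφp, hfp] at h1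
    rw [hsph p hp.2 hcp, ← hf c hcσ e heσ] at h2
    rw [← hf c hcσ _ hφe, hcp] at h3
    have q1 := congrArg (· ^ 2) h1
    have q2 := congrArg (· ^ 2) h2
    have q3 := congrArg (· ^ 2) h3
    simp only [mul_pow, sq_abs] at q1 q2 q3
    have hte : f e - f c ≠ 0 := fun h => by rw [h] at hu; simp at hu
    have hs : f (φ e) - f c = -(l ^ 2 * (f e - f c)) := by
      apply mul_left_cancel₀ hr.ne'
      linear_combination (q1 - q2 - q3) / 2
    have hmul : (f (φ e) - f c) * (f e - f c) = (u - f c) * (f e - f c) := by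
      rw [hs]
      linear_combination q2 - hr2
    linarith [mul_right_cancel₀ hte hmul]
  intro x hx
  by_cases hxω : x = ω
  · rw [hxω]
    exact hω.2
  obtain ⟨y, hy, hyx⟩ : f x ∈ f '' ((σ ∩ σ') \ {ω}) := hC ▸ Set.mem_univ _
  rw [← hinj y ⟨hy.1.1, hy.2⟩ x ⟨hx, hxω⟩ hyx]
  exact hy.1.2

end PtolemyCircle

/-- Corollary 4.4 of the paper.  In a Ptolemy space with properties
(E) and (I), any two distinct Ptolemy circles have at most two points in common. -/
theorem stmt_5 {X : Type*} (S : MobiusStructure X)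
    (hpt : IsPtolemyStructure S) (hE : PropertyE S) (hI : PropertyI S)
    (σ σ' : Set X) (hσ : IsPtolemyCircle S σ) (hσ' : IsPtolemyCircle S σ')
    (hne : σ ≠ σ') :
    ∀ a ∈ σ ∩ σ', ∀ b ∈ σ ∩ σ', ∀ c ∈ σ ∩ σ', a = b ∨ a = c ∨ b = c := by
  intro a ha b hb c hc
  by_contra! hcon
  obtain ⟨hab, hac, hbc⟩ := hcon
  exact hne ((hσ.subset_of_three_mem hpt hI hσ' hc ha hb hac hbc hab).antisymm
    (hσ'.subset_of_three_mem hpt hI hσ hc.symm ha.symm hb.symm hac hbc hab))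

end Mobius
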